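/- For every natural number n, f_n^-(x) = Σ (n choose r_0, r_1, …, r_{2k+1}) · x^{k+1} · d_{r_0}(x) · A_{r_1}(x) ⋯ A_{r_{2k+1}}(x), where the sum ranges over all k ∈ ℕ and all sequences (r_0, r_1, …, r_{2k+1}) of nonnegative integers with r_0 + ⋯ + r_{2k+1} = n and r_i ≥ 1 for 1 ≤ i ≤ 2k+1 (equivalently, over all such sequences of nonnegative integers with the convention A_0(x) = 0). -/

import Mathlib

open Polynomial Finset

/-- A signed permutation of `[n]`, encoded by its word: position `i` (0-indexed)
holds the pair (absolute value minus one, sign) of the letter `w(a_{i+1})`. -/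
def IsSP {n : ℕ} (u : Fin n → Fin n × Bool) : Prop :=
  Function.Bijective fun i => (u i).1

instance {n : ℕ} (u : Fin n → Fin n × Bool) : Decidable (IsSP u) :=
  inferInstanceAs (Decidable (Function.Bijective _))

/-- the letter `w(a_{i+1})` at position `i` of the word -/
def letterW {n : ℕ} (u : Fin n → Fin n × Bool) (i : Fin n) : ℤ :=
  if (u i).2 then ((u i).1 : ℤ) + 1 else -(((u i).1 : ℤ) + 1)

/-- `a_{k+1}`: the element of the domain `S` with absolute value `k+1` -/
def aVal {n : ℕ} (u : Fin n → Fin n × Bool) (k : Fin n) : ℤ :=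
  if ∃ j, u j = (k, true) then ((k : ℤ) + 1) else -((k : ℤ) + 1)

/-- the number of type `B` excedances -/
def excB {n : ℕ} (u : Fin n → Fin n × Bool) : ℕ :=
  (univ.filter fun k : Fin n =>
    aVal u k < letterW u k ∨ (aVal u k < 0 ∧ letterW u k = aVal u k)).card

/-- a derangement: no positive fixed point -/
def IsDerB {n : ℕ} (u : Fin n → Fin n × Bool) : Prop :=
  ∀ k : Fin n, 0 < aVal u k → letterW u k ≠ aVal u k

instance {n : ℕ} (u : Fin n → Fin n × Bool) : Decidable (IsDerB u) := by
  unfold IsDerB; infer_instance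

/-- the type `B` derangement polynomial -/
noncomputable def dB (n : ℕ) : Polynomial ℝ :=
  ∑ u ∈ univ.filter (fun u : Fin n → Fin n × Bool => IsSP u ∧ IsDerB u), X ^ excB u

/-- the number of type `B` descents -/
def desB {n : ℕ} (u : Fin n → Fin n × Bool) : ℕ :=
  (univ.filter fun i : Fin n =>
    ((i : ℕ) = 0 ∧ letterW u i < 0) ∨
    (0 < (i : ℕ) ∧ letterW u i < letterW u ⟨(i : ℕ) - 1, by have := i.isLt; omega⟩)).card

/-- the type `B` Eulerian polynomial -/
noncomputable def Bpoly (n : ℕ) : Polynomial ℝ :=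
  ∑ u ∈ univ.filter (fun u : Fin n → Fin n × Bool => IsSP u), X ^ desB u

/-- the "positive half" type `B` Eulerian polynomial -/
noncomputable def Bplus : ℕ → Polynomial ℝ
  | 0 => 1
  | n + 1 =>
    ∑ u ∈ univ.filter (fun u : Fin (n + 1) → Fin (n + 1) × Bool =>
        IsSP u ∧ 0 < letterW u (Fin.last n)), X ^ desB u

/-- the "negative half" type `B` Eulerian polynomial -/
noncomputable def Bminus : ℕ → Polynomial ℝ
  | 0 => 0
  | n + 1 =>
    ∑ u ∈ univ.filter (fun u : Fin (n + 1) → Fin (n + 1) × Bool =>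
        IsSP u ∧ letterW u (Fin.last n) < 0), X ^ desB u

/-- the number of excedances of a permutation -/
def excA {n : ℕ} (w : Equiv.Perm (Fin n)) : ℕ :=
  (univ.filter fun i : Fin n => i < w i).card

/-- the number of descents of a permutation -/
def desA {n : ℕ} (w : Equiv.Perm (Fin n)) : ℕ :=
  (univ.filter fun i : Fin n =>
    (i : ℕ) + 1 < n ∧ w ⟨((i : ℕ) + 1) % n, Nat.mod_lt _ i.pos⟩ < w i).card

/-- the (type `A`) derangement polynomial -/
noncomputable def dA (n : ℕ) : Polynomial ℝ :=
  ∑ w ∈ univ.filter (fun w : Equiv.Perm (Fin n) => ∀ i, w i ≠ i), X ^ excA w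

/-- the Eulerian polynomial, with the convention `A_0 = 0` -/
noncomputable def Apoly (n : ℕ) : Polynomial ℝ :=
  if n = 0 then 0 else ∑ w : Equiv.Perm (Fin n), X ^ desA w

/-- weights -/
noncomputable def wtB {α : Type} [DecidableEq α] (κ : α → ℤ) (y : α → ℝ[X]) (w : Equiv.Perm α) (i : α) : ℝ[X] :=
  if κ i < κ (w i) then X else if w i = i then y i else 1

lemma der_card {β : Type} [Fintype β] [DecidableEq β] (κ : β → ℤ) (hκ : Function.Injective κ) :
    ∑ w ∈ univ.filter (fun w : Equiv.Perm β => ∀ i, w i ≠ i), ∏ i, (if κ i < κ (w i) then (X : ℝ[X]) else 1)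
      = dA (Fintype.card β) := by
  let _ : LinearOrder β := LinearOrder.lift' κ hκ
  have hlt : ∀ a b : β, κ a < κ b ↔ a < b := fun a b => Iff.rfl
  let e : Fin (Fintype.card β) ≃o β := Fintype.orderIsoFinOfCardEq β rfl
  unfold dA
  refine Finset.sum_equiv (Equiv.permCongr e.toEquiv.symm) ?_ ?_
  · intro w
    simp only [Finset.mem_filter, Finset.mem_univ, true_and, Equiv.permCongr_apply, Equiv.symm_symm]
    constructor
    · intro h i hi
      apply h (e i)
      have := congrArg e hi
      simpa using this
    · intro h i hi
      apply h (e.symm i)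
      simp [hi]
  · intro w _
    simp only [hlt]
    rw [Finset.prod_ite]
    simp only [Finset.prod_const, one_pow, mul_one, excA]
    congr 1
    refine Finset.card_equiv e.toEquiv.symm ?_
    intro i
    rw [Finset.mem_filter, Finset.mem_filter]
    simp

lemma gen_sum {α : Type} [Fintype α] [DecidableEq α] (κ : α → ℤ) (hκ : Function.Injective κ)
    (y : α → ℝ[X]) :
    ∑ w : Equiv.Perm α, ∏ i, wtB κ y w i
      = ∑ J : Finset α, (∏ i ∈ J, y i) * dA (Fintype.card α - J.card) := by
  rw [← Finset.sum_fiberwise univ (fun w : Equiv.Perm α => univ.filter (fun i => w i = i))]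
  refine Finset.sum_congr rfl fun J _ => ?_
  have hc : Fintype.card α - J.card = Fintype.card {i // i ∉ J} := by
    simp [Fintype.card_subtype_compl]
  rw [hc, ← der_card (fun i : {i // i ∉ J} => κ i) (fun a b h => Subtype.ext (hκ h)), Finset.mul_sum]
  symm
  refine Finset.sum_nbij (fun v => Equiv.Perm.ofSubtype v) ?_ ?_ ?_ ?_
  · intro v hv
    simp only [Finset.mem_filter, Finset.mem_univ, true_and] at hv ⊢
    ext i
    simp only [Finset.mem_filter, Finset.mem_univ, true_and]
    by_cases hi : i ∈ J
    · simp [hi, Equiv.Perm.ofSubtype_apply_of_not_mem]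
    · simp only [hi, iff_false]
      rw [Equiv.Perm.ofSubtype_apply_of_mem v (p := fun i => i ∉ J) hi]
      intro h
      exact hv ⟨i, hi⟩ (Subtype.ext h)
  · intro a _ b _ h
    exact Equiv.Perm.ofSubtype_injective h
  · intro w hw
    simp only [Finset.coe_filter, Finset.mem_univ, true_and, Set.mem_ofPred_eq] at hw
    have hw' : ∀ i, w i = i ↔ i ∈ J := by
      intro i; rw [← hw]; simp
    have h1 : ∀ i, (w i ∉ J) ↔ (i ∉ J) := by
      intro i
      rw [← hw', ← hw']
      simp
    refine ⟨w.subtypePerm h1, ?_, ?_⟩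
    · simp only [Finset.coe_filter, Finset.mem_univ, true_and, Set.mem_ofPred_eq]
      rintro ⟨i, hi⟩ h
      apply hi
      rw [← hw']
      exact congrArg Subtype.val h
    · apply Equiv.Perm.ofSubtype_subtypePerm
      intro i hi
      rwa [Ne, hw'] at hi
  · intro v hv
    simp only [Finset.mem_filter, Finset.mem_univ, true_and] at hv
    rw [← Finset.prod_mul_prod_compl J]
    congr 1
    · refine Finset.prod_congr rfl fun i hi => ?_
      have : Equiv.Perm.ofSubtype v i = i :=
        Equiv.Perm.ofSubtype_apply_of_not_mem v (p := fun i => i ∉ J) (by simpa using hi)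
      simp [wtB, this]
    · rw [Finset.prod_subtype (Jᶜ) (p := fun i => i ∉ J) (by simp)]
      refine Finset.prod_congr rfl fun i _ => ?_
      have : Equiv.Perm.ofSubtype v i = v i :=
        Equiv.Perm.ofSubtype_apply_of_mem v (p := fun i => i ∉ J) i.2
      have h2 : ((v i : {i // i ∉ J}) : α) ≠ i := fun h => hv i (Subtype.ext h)
      simp [wtB, this, h2]

lemma sum_finset_card {n : ℕ} (f : ℕ → ℝ[X]) :
    ∑ J : Finset (Fin n), f J.card = ∑ j ∈ Finset.range (n+1), (n.choose j : ℝ[X]) * f j := by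
  have := Finset.sum_powerset_apply_card f (x := (Finset.univ : Finset (Fin n)))
  simp only [Finset.powerset_univ, Finset.card_univ, Fintype.card_fin, nsmul_eq_mul] at this
  exact this

lemma wtB_last_one {m : ℕ} (w : Equiv.Perm (Fin (m+1))) :
    wtB (fun i : Fin (m+1) => (i : ℤ)) (fun _ => 1) w (Fin.last m) = 1 := by
  have h3 := (w (Fin.last m)).2
  simp only [wtB, Fin.val_last, ite_self]
  rw [if_neg]
  omega

lemma exc_rec (n : ℕ) (hn : 1 ≤ n) :
    ∑ j ∈ Finset.range (n+1), (n.choose j : ℝ[X]) * (X ^ j * dA (n - j))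
     = X * ∑ j ∈ Finset.range (n+1), (n.choose j : ℝ[X]) * dA (n - j) := by
  have key : ∀ y : ℝ[X], ∑ w : Equiv.Perm (Fin n), ∏ i, wtB (fun i : Fin n => (i : ℤ)) (fun _ => y) w i
      = ∑ j ∈ Finset.range (n+1), (n.choose j : ℝ[X]) * (y ^ j * dA (n - j)) := by
    intro y
    rw [gen_sum _ (fun a b h => by simpa [Fin.ext_iff] using h)]
    simp only [Finset.prod_const, Fintype.card_fin]
    exact sum_finset_card (fun j => y ^ j * dA (n - j))
  have k1 := key 1
  simp only [one_pow, one_mul] at k1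
  rw [← key X, ← k1, Finset.mul_sum]
  obtain ⟨m, rfl⟩ : ∃ m, n = m + 1 := ⟨n - 1, by omega⟩
  symm
  refine Fintype.sum_equiv (Equiv.mulRight (finRotate (m+1))⁻¹) _ _ ?_
  intro w
  refine Eq.trans ?_ (Equiv.prod_comp (finRotate (m+1)) _)
  rw [Fin.prod_univ_castSucc, Fin.prod_univ_castSucc (n := m), mul_comm, wtB_last_one, mul_one]
  congr 1
  · refine Finset.prod_congr rfl fun i _ => ?_
    simp only [wtB, Equiv.coe_mulRight, Equiv.Perm.mul_apply, finRotate_apply]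
    have : (Fin.castSucc i + 1 : Fin (m+1)) = i.succ := by simp
    have h2 : (finRotate (m+1))⁻¹ i.succ = i.castSucc := by
      rw [Equiv.Perm.inv_eq_iff_eq]; simp
    simp only [this, h2, Fin.ext_iff]
    simp only [Fin.val_castSucc, Fin.val_succ]
    split_ifs <;> first | rfl | omega
  · simp only [wtB, Equiv.coe_mulRight, Equiv.Perm.mul_apply, finRotate_apply]
    have h2 : (finRotate (m+1))⁻¹ 0 = Fin.last m := by
      rw [Equiv.Perm.inv_eq_iff_eq]; simp
    have h3 := (w (Fin.last m)).2
    simp only [Fin.last_add_one, h2, Fin.ext_iff]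
    simp only [Fin.val_zero]
    rcases Nat.eq_zero_or_pos (w (Fin.last m)).val with h | h <;> simp [h]

/-- signed key -/
def kapS {n : ℕ} (s : Fin n → Bool) (k : Fin n) : ℤ := if s k then (k : ℤ) + 1 else -((k : ℤ) + 1)

lemma kapS_inj {n : ℕ} (s : Fin n → Bool) : Function.Injective (kapS s) := by
  intro a b h
  simp only [kapS] at h
  ext
  split_ifs at h <;> omega

lemma dB_term {n : ℕ} (σ : Equiv.Perm (Fin n)) (s : Fin n → Bool) :
    (if IsDerB (fun i => (σ i, s (σ i))) then (X : ℝ[X]) ^ excB (fun i => (σ i, s (σ i))) else 0)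
      = ∏ i, wtB (kapS s) (fun i => if s i then 0 else X) σ i := by
  have ha : ∀ k, aVal (fun i => (σ i, s (σ i))) k = kapS s k := by
    intro k
    simp only [aVal, kapS]
    congr 1
    simp only [Prod.mk.injEq, eq_iff_iff]
    constructor
    · rintro ⟨j, rfl, h⟩; exact h
    · intro h; exact ⟨σ.symm k, by simp, by simpa using h⟩
  have hl : ∀ k, letterW (fun i => (σ i, s (σ i))) k = kapS s (σ k) := by
    intro k; rfl
  have hpos : ∀ k, 0 < kapS s k ↔ s k = true := by
    intro k; simp only [kapS]; split_ifs with h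
    · simp [h] <;> omega
    · simp [h] <;> omega
  have hneg : ∀ k, kapS s k < 0 ↔ ¬ s k = true := by
    intro k; simp only [kapS]; split_ifs with h
    · simp [h] <;> omega
    · simp [h] <;> omega
  have heq : ∀ k, kapS s (σ k) = kapS s k ↔ σ k = k := fun k => (kapS_inj s).eq_iff
  simp only [IsDerB, excB, ha, hl, hpos, hneg, Ne, heq]
  split_ifs with h
  · rw [← Finset.prod_const, Finset.prod_filter]
    refine Finset.prod_congr rfl fun i _ => ?_
    simp only [wtB]
    have := h i
    by_cases h1 : kapS s i < kapS s (σ i)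
    · simp [h1]
    · by_cases h2 : σ i = i
      · have h3 : ¬ s i = true := fun h3 => this h3 h2
        simp [h2, h3]
      · simp [h1, h2]
  · push Not at h
    obtain ⟨k, hk, hk2⟩ := h
    symm
    apply Finset.prod_eq_zero (Finset.mem_univ k)
    simp [wtB, hk, hk2]

lemma dB_eq (n : ℕ) : dB n = ∑ j ∈ Finset.range (n+1), (n.choose j : ℝ[X]) * (X ^ j * 2 ^ (n - j) * dA (n - j)) := by
  have h1 : dB n = ∑ s : Fin n → Bool, ∑ σ : Equiv.Perm (Fin n),
      ∏ i, wtB (kapS s) (fun i => if s i then 0 else X) σ i := by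
    rw [dB, ← Finset.filter_filter, Finset.sum_filter]
    rw [← Finset.sum_product']
    refine (Finset.sum_bij (fun p _ => fun i => (p.2 i, p.1 (p.2 i))) ?_ ?_ ?_ ?_).symm
    · rintro ⟨s, σ⟩ _
      simp only [Finset.mem_filter, Finset.mem_univ, true_and, IsSP]
      exact σ.bijective
    · rintro ⟨s, σ⟩ _ ⟨s', σ'⟩ _ h
      have h1 : σ = σ' := by
        ext i : 1
        exact congrArg Prod.fst (congrFun h i)
      subst h1
      have h2 : s = s' := by
        ext i : 1
        simpa using congrArg Prod.snd (congrFun h (σ.symm i))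
      rw [h2]
    · intro u hu
      simp only [Finset.mem_filter, Finset.mem_univ, true_and, IsSP] at hu
      refine ⟨(fun k => (u ((Equiv.ofBijective _ hu).symm k)).2, Equiv.ofBijective _ hu), by simp, ?_⟩
      ext i : 1
      simp only [Equiv.symm_apply_apply]
      rfl
    · rintro ⟨s, σ⟩ _
      exact (dB_term σ s).symm
  rw [h1]
  simp only [gen_sum _ (kapS_inj _)]
  rw [Finset.sum_comm, ← sum_finset_card (fun j => X ^ j * 2 ^ (n - j) * dA (n - j))]
  refine Finset.sum_congr rfl fun J _ => ?_
  rw [← Finset.sum_mul, Fintype.card_fin]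
  congr 1
  have h2 : ∀ s : Fin n → Bool, (∏ i ∈ J, if s i = true then (0 : ℝ[X]) else X)
      = ∏ i, if i ∈ J then (if s i = true then (0 : ℝ[X]) else X) else 1 := by
    intro s
    rw [Finset.prod_ite_mem, Finset.univ_inter]
  simp only [h2]
  have h3 := (Finset.prod_univ_sum (fun _ : Fin n => (Finset.univ : Finset Bool))
    (fun i b => if i ∈ J then (if b = true then (0 : ℝ[X]) else X) else 1)).symm
  rw [Fintype.piFinset_univ] at h3
  rw [h3]
  have h4 : ∀ i : Fin n, (∑ b : Bool, if i ∈ J then (if b = true then (0 : ℝ[X]) else X) else 1)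
      = if i ∈ J then X else 2 := by
    intro i
    split_ifs <;> simp
  simp only [h4, Finset.prod_ite, Finset.prod_const]
  congr 2
  · simp
  · rw [Finset.filter_not, Finset.card_sdiff]; simp

lemma desA_succ {m : ℕ} (w : Equiv.Perm (Fin (m+1))) :
    desA w = ∑ i : Fin m, if w i.succ < w i.castSucc then 1 else 0 := by
  rw [desA, Finset.card_filter, Fin.sum_univ_castSucc]
  simp only [Fin.val_last, lt_irrefl, false_and, if_false, add_zero]
  refine Finset.sum_congr rfl fun i _ => ?_
  have h : (⟨((i.castSucc : Fin (m+1)) + 1 : ℕ) % (m+1), Nat.mod_lt _ i.castSucc.pos⟩ : Fin (m+1)) = i.succ := by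
    ext
    simp only [Fin.val_castSucc, Fin.val_succ]
    exact Nat.mod_eq_of_lt (by omega)
  rw [h]
  simp

/-- prepend a first letter -/
noncomputable def consPerm {n : ℕ} (p : Fin (n+1)) (e : Equiv.Perm (Fin n)) : Equiv.Perm (Fin (n+1)) :=
  Equiv.ofBijective (Fin.cons p (fun i => p.succAbove (e i)) : Fin (n+1) → Fin (n+1)) (by
    rw [← Finite.injective_iff_bijective, Fin.cons_injective_iff]
    constructor
    · rintro ⟨i, hi⟩
      exact Fin.succAbove_ne _ _ hi
    · intro a b h
      exact e.injective (Fin.succAbove_right_injective h))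

lemma consPerm_zero {n : ℕ} (p : Fin (n+1)) (e : Equiv.Perm (Fin n)) : consPerm p e 0 = p := by
  simp [consPerm]

lemma consPerm_succ {n : ℕ} (p : Fin (n+1)) (e : Equiv.Perm (Fin n)) (i : Fin n) :
    consPerm p e i.succ = p.succAbove (e i) := by
  simp [consPerm]

lemma consPerm_bij (n : ℕ) :
    Function.Bijective (fun q : Fin (n+1) × Equiv.Perm (Fin n) => consPerm q.1 q.2) := by
  rw [Fintype.bijective_iff_injective_and_card]
  constructor
  · rintro ⟨p, e⟩ ⟨p', e'⟩ h
    simp only at h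
    have h0 : p = p' := by rw [← consPerm_zero p e, h, consPerm_zero]
    subst h0
    have : e = e' := by
      ext i : 1
      have := congrArg (fun w => w i.succ) h
      simp only [consPerm_succ] at this
      exact Fin.succAbove_right_injective this
    rw [this]
  · simp [Fintype.card_perm, Nat.factorial_succ]

/-- Eulerian polynomial refined by first letter -/
noncomputable def aRef (n : ℕ) (i : Fin (n+1)) : ℝ[X] :=
  ∑ w ∈ univ.filter (fun w : Equiv.Perm (Fin (n+1)) => w 0 = i), X ^ desA w

lemma aRef_eq (n : ℕ) (p : Fin (n+1)) :
    aRef n p = ∑ e : Equiv.Perm (Fin n), X ^ desA (consPerm p e) := by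
  rw [aRef, Finset.sum_filter,
    ← Equiv.sum_comp (Equiv.ofBijective _ (consPerm_bij n)), Fintype.sum_prod_type]
  simp only [Equiv.ofBijective_apply, consPerm_zero]
  rw [Finset.sum_eq_single p]
  · simp
  · intro b _ hb
    simp [hb]
  · simp

lemma des_cons {n : ℕ} (p : Fin (n+2)) (e : Equiv.Perm (Fin (n+1))) :
    desA (consPerm p e) = (if ((e 0 : Fin (n+1)) : ℕ) < p then 1 else 0) + desA e := by
  rw [desA_succ, desA_succ, Fin.sum_univ_succ]
  congr 1
  · rw [consPerm_succ, Fin.castSucc_zero, consPerm_zero]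
    simp only [Fin.succAbove_lt_iff_castSucc_lt]
    simp [Fin.lt_def]
  · refine Finset.sum_congr rfl fun i _ => ?_
    rw [consPerm_succ, ← Fin.succ_castSucc, consPerm_succ]
    simp [Fin.succAbove_lt_succAbove_iff]

lemma aRef_rec (n : ℕ) (p : Fin (n+2)) :
    aRef (n+1) p = ∑ j : Fin (n+1), X ^ (if (j : ℕ) < p then 1 else 0) * aRef n j := by
  rw [aRef_eq, ← Finset.sum_fiberwise univ (fun w : Equiv.Perm (Fin (n+1)) => w 0)]
  refine Finset.sum_congr rfl fun j _ => ?_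
  rw [aRef, Finset.mul_sum]
  refine Finset.sum_congr rfl fun w hw => ?_
  simp only [Finset.mem_filter, Finset.mem_univ, true_and] at hw
  rw [des_cons, pow_add, hw]

lemma ps_shift (f : ℕ → ℝ) (h : f 0 = 0) :
    (PowerSeries.X : PowerSeries ℝ) * PowerSeries.mk (fun m => f (m+1)) = PowerSeries.mk f := by
  ext m
  cases m with
  | zero => simp [h]
  | succ m => rw [PowerSeries.coeff_succ_X_mul]; simp

lemma ps_key (n p : ℕ) (hp : p ≤ n + 1) :
    ∑ j ∈ Finset.range (n+1), (PowerSeries.X : PowerSeries ℝ) ^ (if j < p then 1 else 0)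
        * PowerSeries.mk (fun m : ℕ => (m : ℝ)^j * ((m : ℝ)+1)^(n - j))
      = (1 - PowerSeries.X) * PowerSeries.mk (fun m : ℕ => (m : ℝ)^p * ((m : ℝ)+1)^(n + 1 - p)) := by
  have tel : ∀ j, j ≤ n → PowerSeries.mk (fun m : ℕ => (m : ℝ)^j * ((m : ℝ)+1)^(n - j))
      = PowerSeries.mk (fun m : ℕ => (m : ℝ)^j * ((m : ℝ)+1)^(n + 1 - j))
       - PowerSeries.mk (fun m : ℕ => (m : ℝ)^(j+1) * ((m : ℝ)+1)^(n + 1 - (j+1))) := by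
    intro j hj
    ext m
    simp only [PowerSeries.coeff_mk, map_sub]
    rw [show n + 1 - j = (n - j) + 1 by omega, show n + 1 - (j+1) = n - j by omega]
    ring
  induction p with
  | zero =>
    simp only [Nat.not_lt_zero, if_false, pow_zero, one_mul, Nat.sub_zero]
    rw [Finset.sum_congr rfl (fun j hj => tel j (by simpa [Nat.lt_succ_iff] using hj)),
      Finset.sum_range_sub', sub_mul]
    congr 1
    · simp
    · have := ps_shift (fun m => (m : ℝ)^(n+1)) (by simp)
      push_cast at this
      rw [this]
      simp
  | succ p ih =>
    have ih := ih (by omega)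
    have t := tel p (by omega)
    have hsub : ∑ j ∈ Finset.range (n+1), (PowerSeries.X : PowerSeries ℝ) ^ (if j < p + 1 then 1 else 0)
        * PowerSeries.mk (fun m : ℕ => (m : ℝ)^j * ((m : ℝ)+1)^(n - j))
        - ∑ j ∈ Finset.range (n+1), (PowerSeries.X : PowerSeries ℝ) ^ (if j < p then 1 else 0)
        * PowerSeries.mk (fun m : ℕ => (m : ℝ)^j * ((m : ℝ)+1)^(n - j))
        = (PowerSeries.X - 1) * PowerSeries.mk (fun m : ℕ => (m : ℝ)^p * ((m : ℝ)+1)^(n - p)) := by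
      rw [← Finset.sum_sub_distrib, Finset.sum_eq_single p]
      · simp [sub_mul]
      · intro j _ hj
        have : j < p + 1 ↔ j < p := by omega
        simp [this]
      · intro h; simp at h; omega
    rw [ih] at hsub
    rw [eq_add_of_sub_eq hsub, t]
    ring

lemma aRef_closed (n : ℕ) (i : Fin (n+1)) :
    (aRef n i : PowerSeries ℝ) = (1 - PowerSeries.X)^(n+1) *
      PowerSeries.mk (fun m : ℕ => (m : ℝ)^(i : ℕ) * ((m : ℝ)+1)^(n - i)) := by
  induction n with
  | zero =>
    have hi : i = 0 := by ext; simp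
    subst hi
    have : aRef 0 0 = 1 := by
      rw [aRef]
      have : ∀ w : Equiv.Perm (Fin 1), w 0 = 0 := fun w => Subsingleton.elim _ _
      simp [desA_succ, this]
    rw [this]
    simp only [Fin.val_zero, pow_zero, one_mul, zero_add, pow_one, Nat.sub_self]
    rw [mul_comm]
    have := PowerSeries.mk_one_mul_one_sub_eq_one ℝ
    rw [show (PowerSeries.mk 1 : PowerSeries ℝ) = PowerSeries.mk (fun _ => 1) from rfl] at this
    simpa using this.symm
  | succ n ih =>
    rw [aRef_rec]
    have hk := ps_key n i (by omega)
    rw [pow_succ, mul_assoc, ← hk, Finset.mul_sum,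
      ← Fin.sum_univ_eq_sum_range (fun j => (1 - PowerSeries.X) ^ (n + 1) * ((PowerSeries.X : PowerSeries ℝ) ^ (if j < (i : ℕ) then 1 else 0)
        * PowerSeries.mk (fun m : ℕ => (m : ℝ)^j * ((m : ℝ)+1)^(n - j))))]
    rw [← Polynomial.coeToPowerSeries.ringHom_apply, map_sum]
    refine Finset.sum_congr rfl fun j _ => ?_
    rw [map_mul, map_pow]
    simp only [Polynomial.coeToPowerSeries.ringHom_apply, ih, Polynomial.coe_X]
    ring

/-- Eulerian polynomial with value one at zero -/
noncomputable def Ahat (n : ℕ) : ℝ[X] := if n = 0 then 1 else Apoly n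

lemma Ahat_closed (n : ℕ) :
    (Ahat n : PowerSeries ℝ) = (1 - PowerSeries.X)^(n+1) *
      PowerSeries.mk (fun m : ℕ => ((m : ℝ)+1)^n) := by
  cases n with
  | zero =>
    have := PowerSeries.mk_one_mul_one_sub_eq_one ℝ
    rw [show (PowerSeries.mk 1 : PowerSeries ℝ) = PowerSeries.mk (fun _ => 1) from rfl] at this
    rw [mul_comm] at this
    simpa [Ahat] using this.symm
  | succ n =>
    have h : Ahat (n+1) = aRef (n+1) 0 := by
      rw [aRef_rec]
      simp only [Ahat, Apoly, Nat.succ_ne_zero, if_false, Fin.val_zero, Nat.not_lt_zero, pow_zero, one_mul]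
      rw [← Finset.sum_fiberwise univ (fun w : Equiv.Perm (Fin (n+1)) => w 0)]
      rfl
    rw [h, aRef_closed]
    simp

lemma des_rec (n : ℕ) (hn : 1 ≤ n) :
    ∑ j ∈ Finset.range (n+1), (n.choose j : ℝ[X]) * ((X - 1)^(n-j) * Ahat j) = X * Ahat n := by
  apply Polynomial.coe_injective
  rw [← Polynomial.coeToPowerSeries.ringHom_apply, ← Polynomial.coeToPowerSeries.ringHom_apply, map_sum, map_mul]
  simp only [map_mul, map_pow, map_sub, map_one, map_natCast, Polynomial.coeToPowerSeries.ringHom_apply, Polynomial.coe_X, Ahat_closed]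
  have h1 := ps_shift (fun m => (m : ℝ)^n) (by simp; omega)
  push_cast at h1
  rw [mul_left_comm, h1]
  have h2 : (PowerSeries.mk fun m : ℕ => (m : ℝ)^n) = ∑ j ∈ Finset.range (n+1),
      (n.choose j : PowerSeries ℝ) * ((-1)^(n-j) * PowerSeries.mk (fun m : ℕ => ((m : ℝ)+1)^j)) := by
    ext m
    rw [map_sum, PowerSeries.coeff_mk]
    have := add_pow ((m : ℝ)+1) (-1) n
    rw [show (m : ℝ) + 1 + -1 = m by ring] at this
    rw [this]
    refine Finset.sum_congr rfl fun j _ => ?_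
    have h3 : (n.choose j : PowerSeries ℝ) * ((-1)^(n-j) * PowerSeries.mk (fun m : ℕ => ((m : ℝ)+1)^j))
      = PowerSeries.C ((n.choose j : ℝ) * (-1)^(n-j)) * PowerSeries.mk (fun m : ℕ => ((m : ℝ)+1)^j) := by
      simp [mul_assoc]
    rw [h3, PowerSeries.coeff_C_mul, PowerSeries.coeff_mk]
    ring
  rw [h2, Finset.mul_sum]
  refine Finset.sum_congr rfl fun j hj => ?_
  have hj' : j ≤ n := by simpa [Nat.lt_succ_iff] using hj
  have : (1 - PowerSeries.X : PowerSeries ℝ)^(n+1) = (1 - PowerSeries.X)^(n-j) * (1 - PowerSeries.X)^(j+1) := by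
    rw [← pow_add]; congr 1; omega
  rw [this, show (PowerSeries.X - 1 : PowerSeries ℝ) = (-1) * (1 - PowerSeries.X) by ring, mul_pow]
  ring

/-- functional palindromicity -/
def PalF (m : ℤ) (p : ℝ[X]) : Prop := ∀ y : ℝ, y ≠ 0 → p.eval y = y ^ m * p.eval y⁻¹

lemma pal_pow (y : ℝ) (hy : y ≠ 0) {a b n : ℕ} (h : a + b = n) : y ^ a = y ^ n * y⁻¹ ^ b := by
  rw [← h, pow_add, inv_pow, mul_assoc, mul_inv_cancel₀ (pow_ne_zero _ hy), mul_one]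

lemma dA_pal (n : ℕ) : PalF n (dA n) := by
  intro y hy
  simp only [dA, Polynomial.eval_finsetSum, Polynomial.eval_pow, Polynomial.eval_X, Finset.mul_sum]
  refine Finset.sum_equiv (Equiv.inv _) ?_ ?_
  · intro w
    simp only [Finset.mem_filter, Finset.mem_univ, true_and, Equiv.inv_apply, Ne, Equiv.Perm.inv_eq_iff_eq]
    simp only [eq_comm]
  · intro w hw
    simp only [Finset.mem_filter, Finset.mem_univ, true_and, Equiv.inv_apply] at hw ⊢
    have h1 : excA w⁻¹ = (univ.filter fun i => ¬ i < w i).card := by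
      refine Finset.card_equiv w⁻¹ ?_
      intro i
      have h2 := hw (w⁻¹ i)
      simp at h2 ⊢
      exact ⟨le_of_lt, fun h => lt_of_le_of_ne h h2⟩
    have h3 : excA w + excA w⁻¹ = n := by
      rw [h1, excA, Finset.card_filter_add_card_filter_not]; simp
    rw [zpow_natCast]
    exact pal_pow y hy h3

lemma Apoly_pal (n : ℕ) : PalF (n - 1) (Apoly n) := by
  intro y hy
  cases n with
  | zero => simp [Apoly]
  | succ m =>
    simp only [Apoly, Nat.succ_ne_zero, if_false, Polynomial.eval_finsetSum, Polynomial.eval_pow, Polynomial.eval_X, Finset.mul_sum]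
    refine Fintype.sum_equiv (Equiv.mulLeft (Fin.revPerm : Equiv.Perm (Fin (m+1)))) _ _ ?_
    intro w
    have h3 : desA w + desA (Fin.revPerm * w) = m := by
      rw [desA_succ, desA_succ, ← Finset.sum_add_distrib]
      have : ∀ i : Fin m, ((if w i.succ < w i.castSucc then 1 else 0) +
        (if (Fin.revPerm * w : Equiv.Perm (Fin (m+1))) i.succ < (Fin.revPerm * w : Equiv.Perm (Fin (m+1))) i.castSucc then 1 else 0)) = 1 := by
        intro i
        simp only [Equiv.Perm.mul_apply, Fin.revPerm_apply, Fin.rev_lt_rev]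
        have : w i.succ ≠ w i.castSucc := by
          intro h
          have := w.injective h
          simp [Fin.ext_iff] at this
        rcases lt_or_gt_of_ne this with h | h
        · simp [h, not_lt_of_gt h]
        · simp [h, not_lt_of_gt h]
      rw [Finset.sum_congr rfl fun i _ => this i]
      simp
    rw [show (((m + 1 : ℕ) : ℤ) - 1) = ((m : ℕ) : ℤ) by push_cast; ring, zpow_natCast]
    exact pal_pow y hy h3

/-- exponential generating function -/
noncomputable def egf (f : ℕ → ℝ[X]) : PowerSeries ℝ[X] :=
  PowerSeries.mk fun n => Polynomial.C ((n.factorial : ℝ)⁻¹) * f n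

lemma coeff_egf (f : ℕ → ℝ[X]) (n : ℕ) :
    PowerSeries.coeff n (egf f) = Polynomial.C ((n.factorial : ℝ)⁻¹) * f n := by
  simp [egf]

lemma egf_mul (f g : ℕ → ℝ[X]) :
    egf f * egf g = egf (fun n => ∑ j ∈ Finset.range (n+1), (n.choose j : ℝ[X]) * (f j * g (n - j))) := by
  ext1 n
  rw [PowerSeries.coeff_mul, coeff_egf, Finset.mul_sum,
    Finset.Nat.sum_antidiagonal_eq_sum_range_succ_mk]
  refine Finset.sum_congr rfl fun j hj => ?_
  have hj' : j ≤ n := by simpa [Nat.lt_succ_iff] using hj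
  simp only [coeff_egf]
  have h : (j.factorial : ℝ)⁻¹ * ((n-j).factorial : ℝ)⁻¹ = (n.factorial : ℝ)⁻¹ * (n.choose j : ℝ) := by
    rw [Nat.cast_choose ℝ hj']
    have := Nat.factorial_ne_zero n
    field_simp
  have h2 := congrArg (Polynomial.C : ℝ → ℝ[X]) h
  simp only [map_mul, map_natCast] at h2
  linear_combination (f j * g (n-j)) * h2

lemma egf_rescale (f : ℕ → ℝ[X]) :
    PowerSeries.rescale (2 : ℝ[X]) (egf f) = egf (fun n => 2 ^ n * f n) := by
  ext1 n
  rw [PowerSeries.coeff_rescale, coeff_egf, coeff_egf]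
  ring

lemma egf_sub (f g : ℕ → ℝ[X]) : egf f - egf g = egf (fun n => f n - g n) := by
  ext1 n
  rw [map_sub, coeff_egf, coeff_egf, coeff_egf]
  ring

lemma egf_C (f : ℕ → ℝ[X]) (a : ℝ[X]) : PowerSeries.C a * egf f = egf (fun n => a * f n) := by
  ext1 n
  rw [PowerSeries.coeff_C_mul, coeff_egf, coeff_egf]
  ring

lemma egf_const (f : ℕ → ℝ[X]) (h : ∀ n, 1 ≤ n → f n = 0) : egf f = PowerSeries.C (f 0) := by
  ext1 n
  rw [coeff_egf, PowerSeries.coeff_C]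
  split_ifs with hn
  · subst hn; simp
  · rw [h n (by omega), mul_zero]

/-- exponential of `X t` -/
noncomputable def gE : PowerSeries ℝ[X] := egf (fun n => X ^ n)
/-- exponential of `t` -/
noncomputable def gF : PowerSeries ℝ[X] := egf (fun _ => 1)
/-- derangements -/
noncomputable def gD : PowerSeries ℝ[X] := egf dA
/-- Eulerian -/
noncomputable def gA : PowerSeries ℝ[X] := egf Apoly
/-- type B derangements -/
noncomputable def gB : PowerSeries ℝ[X] := egf dB
/-- the variable as a constant -/
noncomputable def gx : PowerSeries ℝ[X] := PowerSeries.C X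

lemma dA_zero : dA 0 = 1 := by
  rw [dA]
  have : ∀ w : Equiv.Perm (Fin 0), excA w = 0 := fun w => by simp [excA]
  simp [this]

lemma gD_eq : (gE - gx * gF) * gD = 1 - gx := by
  have h1 : gE * gD - gx * (gF * gD) = 1 - gx := by
    rw [gE, gF, gD, gx, egf_mul, egf_mul, egf_C, egf_sub, egf_const]
    · simp [dA_zero]
    · intro n hn
      simp only [one_mul]
      rw [exc_rec n hn, sub_self]
  linear_combination h1

lemma gA_eq : (gE - gx * gF) * gA = gF - gE := by
  have h0 : 1 + gA = egf Ahat := by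
    ext1 n
    rw [map_add, gA, coeff_egf, coeff_egf, PowerSeries.coeff_one]
    cases n with
    | zero => simp [Ahat, Apoly]
    | succ n => simp [Ahat]
  have h1 : gF * egf (fun n => (X - 1)^n) = gE := by
    rw [gF, gE, egf_mul]
    congr 1
    funext n
    have := add_pow (1 : ℝ[X]) (X - 1) n
    rw [show (1 : ℝ[X]) + (X - 1) = X by ring] at this
    rw [this]
    refine Finset.sum_congr rfl fun j _ => ?_
    ring
  have h2 : egf Ahat * egf (fun n => (X - 1)^n) - gx * egf Ahat = 1 - gx := by
    rw [egf_mul, gx, egf_C, egf_sub, egf_const]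
    · simp [Ahat]
    · intro n hn
      rw [← des_rec n hn, sub_eq_zero]
      refine Finset.sum_congr rfl fun j _ => ?_
      ring
  rw [← h0] at h2
  linear_combination gF * h2 - (1 + gA) * h1

lemma gB_eq : gB = gE * PowerSeries.rescale (2 : ℝ[X]) gD := by
  rw [gB, gE, gD, egf_rescale, egf_mul]
  congr 1
  funext n
  rw [dB_eq]
  refine Finset.sum_congr rfl fun j _ => ?_
  ring

lemma gE_two : PowerSeries.rescale (2 : ℝ[X]) gE = gE * gE := by
  rw [gE, egf_rescale, egf_mul]
  congr 1
  funext n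
  have := add_pow (X : ℝ[X]) X n
  rw [← mul_pow, two_mul, this]
  refine Finset.sum_congr rfl fun j _ => ?_
  ring

lemma gF_two : PowerSeries.rescale (2 : ℝ[X]) gF = gF * gF := by
  rw [gF, egf_rescale, egf_mul]
  congr 1
  funext n
  have := add_pow (1 : ℝ[X]) 1 n
  rw [one_add_one_eq_two] at this
  rw [this, mul_one]
  refine Finset.sum_congr rfl fun j _ => ?_
  simp

lemma rescale_gx : PowerSeries.rescale (2 : ℝ[X]) gx = gx := by
  ext1 n
  rw [PowerSeries.coeff_rescale, gx, PowerSeries.coeff_C]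
  split_ifs with h <;> simp [h]

lemma key_identity : gB * (1 - gx * gA ^ 2) = gD * (1 + gx * gA) := by
  have hD := gD_eq
  have hA := gA_eq
  have hD2 := congrArg (PowerSeries.rescale (2 : ℝ[X])) hD
  simp only [map_mul, map_sub, map_one, gE_two, gF_two, rescale_gx] at hD2
  have hX : (1 - X : ℝ[X]) ≠ 0 := by
    intro h
    have := congrArg (Polynomial.eval 0) h
    simp at this
  have cu : PowerSeries.constantCoeff (gE - gx * gF) = 1 - X := by
    rw [← PowerSeries.coeff_zero_eq_constantCoeff_apply, map_sub, gx, PowerSeries.coeff_C_mul, gE, gF, coeff_egf, coeff_egf]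
    simp
  have cv : PowerSeries.constantCoeff (gE * gE - gx * (gF * gF)) = 1 - X := by
    have e1 : PowerSeries.constantCoeff gE = 1 := by
      rw [← PowerSeries.coeff_zero_eq_constantCoeff_apply, gE, coeff_egf]; simp
    have e2 : PowerSeries.constantCoeff gF = 1 := by
      rw [← PowerSeries.coeff_zero_eq_constantCoeff_apply, gF, coeff_egf]; simp
    simp [e1, e2, gx]
  have hu : gE - gx * gF ≠ 0 := by
    intro h; rw [h, map_zero] at cu; exact hX cu.symm
  have hv : gE * gE - gx * (gF * gF) ≠ 0 := by
    intro h; rw [h, map_zero] at cv; exact hX cv.symm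
  rw [gB_eq]
  generalize PowerSeries.rescale (2 : ℝ[X]) gD = D2 at *
  set u := gE - gx * gF with hu'
  set v := gE * gE - gx * (gF * gF) with hv'
  apply mul_left_cancel₀ (mul_ne_zero (pow_ne_zero 2 hu) hv)
  have l1 : u^2 * v * (gE * D2 * (1 - gx * gA^2)) = gE * (1 - gx) * (u^2 - gx * (gF - gE)^2) := by
    calc u^2 * v * (gE * D2 * (1 - gx * gA^2)) = gE * (v * D2) * (u^2 - gx * (u * gA)^2) := by ring
      _ = _ := by rw [hD2, hA]
  have l2 : u^2 * v * (gD * (1 + gx * gA)) = v * (1 - gx) * (u + gx * (gF - gE)) := by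
    calc u^2 * v * (gD * (1 + gx * gA)) = v * (u * gD) * (u + gx * (u * gA)) := by ring
      _ = _ := by rw [hD, hA]
  rw [l1, l2, hu', hv']
  ring

/-- the tuple sums -/
noncomputable def Tsum (m c n : ℕ) : ℝ[X] :=
  ∑ r ∈ Finset.Nat.antidiagonalTuple (m + 1) n,
    (Nat.multinomial Finset.univ r : ℝ[X]) * X ^ c * dA (r 0) * ∏ i : Fin m, Apoly (r i.succ)

lemma coeff_prod_egf (m n : ℕ) (f : Fin m → ℕ → ℝ[X]) :
    PowerSeries.coeff n (∏ i, egf (f i)) = Polynomial.C ((n.factorial : ℝ)⁻¹) *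
      ∑ r ∈ Finset.Nat.antidiagonalTuple m n, (Nat.multinomial Finset.univ r : ℝ[X]) * ∏ i, f i (r i) := by
  rw [PowerSeries.coeff_prod, Finset.mul_sum]
  refine Finset.sum_equiv Finsupp.equivFunOnFinite ?_ ?_
  · intro r
    simp [Finset.Nat.mem_antidiagonalTuple]
  · intro r hr
    have hs : ∑ i, r i = n := by simpa using hr
    simp only [coeff_egf, Finset.prod_mul_distrib, Finsupp.equivFunOnFinite_apply]
    rw [← mul_assoc]
    congr 1
    have h := Nat.multinomial_spec Finset.univ r
    rw [hs] at h
    have h2 : ((∏ i, ((r i).factorial : ℝ)) * (Nat.multinomial Finset.univ r : ℝ)) = n.factorial := by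
      exact_mod_cast h
    have h3 : ∏ i, ((r i).factorial : ℝ)⁻¹ = (n.factorial : ℝ)⁻¹ * (Nat.multinomial Finset.univ r : ℝ) := by
      rw [Finset.prod_inv_distrib, ← h2]
      have e1 : (∏ i, ((r i).factorial : ℝ)) ≠ 0 :=
        Finset.prod_ne_zero_iff.2 fun i _ => by exact_mod_cast Nat.factorial_ne_zero _
      have e2 : (Nat.multinomial Finset.univ r : ℝ) ≠ 0 := by
        intro h0
        rw [h0, mul_zero] at h2
        exact Nat.factorial_ne_zero n (by exact_mod_cast h2.symm)
      field_simp
    rw [← map_prod, h3]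
    simp only [map_mul, map_natCast]
    rfl

lemma coeff_Tsum (m c n : ℕ) :
    PowerSeries.coeff n (gx ^ c * gD * gA ^ m) = Polynomial.C ((n.factorial : ℝ)⁻¹) * Tsum m c n := by
  have h := coeff_prod_egf (m+1) n (Fin.cons dA (fun _ => Apoly))
  rw [Fin.prod_univ_succ] at h
  simp only [Fin.cons_zero, Fin.cons_succ, Finset.prod_const, Finset.card_univ, Fintype.card_fin] at h
  rw [mul_assoc, gx, ← map_pow, PowerSeries.coeff_C_mul]
  rw [gD, gA, h, Tsum]
  simp only [Fin.prod_univ_succ, Fin.cons_zero, Fin.cons_succ, Finset.mul_sum]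
  refine Finset.sum_congr rfl fun r _ => ?_
  ring

lemma gA_dvd : PowerSeries.X ∣ gA := by
  rw [PowerSeries.X_dvd_iff, ← PowerSeries.coeff_zero_eq_constantCoeff_apply, gA, coeff_egf]
  simp [Apoly]

lemma abs_step {R : Type} [CommRing R] (B D x A a v t : R) (n : ℕ)
    (key : B * (1 - x * A ^ 2) = D * (1 + x * A)) (hv : (1 - x * A ^ 2) * v = 1) (ha : A = t * a) :
    B - D * (1 + x * A) * ∑ k ∈ Finset.range (n+1), (x * A^2)^k
      = t ^ (n+1) * ((x * a * A)^(n+1) * (B * (1 - x * A ^ 2)) * v) := by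
  have hg := mul_neg_geom_sum (x * A^2) (n+1)
  have hp : (x * A^2)^(n+1) = t ^ (n+1) * (x * a * A)^(n+1) := by
    rw [← mul_pow]
    congr 1
    linear_combination (x * A) * ha
  rw [← key]
  rw [hp] at hg
  generalize (∑ k ∈ Finset.range (n+1), (x * A^2)^k) = S at *
  generalize (x * a * A)^(n+1) = W at *
  generalize t^(n+1) = T at *
  linear_combination (-B) * hg - T * W * B * hv

lemma dB_split (n : ℕ) : dB n = (∑ k ∈ Finset.range (n+1), Tsum (2*k) k n)
    + ∑ k ∈ Finset.range (n+1), Tsum (2*k+1) (k+1) n := by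
  have hS : ∃ Q, gB - ((∑ k ∈ Finset.range (n+1), gx ^ k * gD * gA ^ (2*k))
      + ∑ k ∈ Finset.range (n+1), gx ^ (k+1) * gD * gA ^ (2*k+1)) = PowerSeries.X ^ (n+1) * Q := by
    have hsum : ((∑ k ∈ Finset.range (n+1), gx ^ k * gD * gA ^ (2*k))
      + ∑ k ∈ Finset.range (n+1), gx ^ (k+1) * gD * gA ^ (2*k+1))
      = gD * (1 + gx * gA) * ∑ k ∈ Finset.range (n+1), (gx * gA^2)^k := by
      rw [← Finset.sum_add_distrib, Finset.mul_sum]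
      refine Finset.sum_congr rfl fun k _ => ?_
      rw [mul_pow, ← pow_mul]
      ring
    have hu : IsUnit (1 - gx * gA ^ 2) := by
      rw [PowerSeries.isUnit_iff_constantCoeff]
      have : PowerSeries.constantCoeff gA = 0 := PowerSeries.X_dvd_iff.1 gA_dvd
      simp [this]
    obtain ⟨v, hv⟩ := hu.exists_right_inv
    obtain ⟨a, ha⟩ := gA_dvd
    rw [hsum]
    exact ⟨_, abs_step _ _ _ _ _ _ _ n key_identity hv ha⟩
  obtain ⟨Q, hQ⟩ := hS
  have h := congrArg (PowerSeries.coeff n) hQ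
  rw [PowerSeries.coeff_X_pow_mul', if_neg (by omega), map_sub, sub_eq_zero, map_add, map_sum, map_sum] at h
  simp only [coeff_Tsum] at h
  rw [gB, coeff_egf, ← Finset.mul_sum, ← Finset.mul_sum, ← mul_add] at h
  refine mul_left_cancel₀ ?_ h
  rw [Ne, Polynomial.C_eq_zero]
  exact inv_ne_zero (by exact_mod_cast Nat.factorial_ne_zero n)

lemma PalF.mul {a b : ℤ} {p q : ℝ[X]} (hp : PalF a p) (hq : PalF b q) : PalF (a + b) (p * q) := by
  intro y hy
  rw [Polynomial.eval_mul, Polynomial.eval_mul, hp y hy, hq y hy, zpow_add₀ hy]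
  ring

lemma PalF.sub {a : ℤ} {p q : ℝ[X]} (hp : PalF a p) (hq : PalF a q) : PalF a (p - q) := by
  intro y hy
  rw [Polynomial.eval_sub, Polynomial.eval_sub, hp y hy, hq y hy]
  ring

lemma PalF.sum {ι : Type} {a : ℤ} (s : Finset ι) (p : ι → ℝ[X]) (hp : ∀ i ∈ s, PalF a (p i)) :
    PalF a (∑ i ∈ s, p i) := by
  intro y hy
  rw [Polynomial.eval_finsetSum, Polynomial.eval_finsetSum, Finset.mul_sum]
  exact Finset.sum_congr rfl fun i hi => hp i hi y hy

lemma PalF.prod {ι : Type} (a : ι → ℤ) (s : Finset ι) (p : ι → ℝ[X]) (hp : ∀ i ∈ s, PalF (a i) (p i)) :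
    PalF (∑ i ∈ s, a i) (∏ i ∈ s, p i) := by
  classical
  induction s using Finset.induction_on with
  | empty => intro y hy; simp
  | insert i s hi ih =>
    rw [Finset.sum_insert hi, Finset.prod_insert hi]
    exact (hp i (Finset.mem_insert_self _ _)).mul (ih fun j hj => hp j (Finset.mem_insert_of_mem hj))

lemma PalF.natCast (N : ℕ) : PalF 0 (N : ℝ[X]) := by
  intro y hy; simp

lemma PalF.X_pow (c : ℕ) : PalF (2 * c) (X ^ c : ℝ[X]) := by
  intro y hy
  rw [show (2 * c : ℤ) = ((c + c : ℕ) : ℤ) by push_cast; ring, zpow_natCast]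
  simpa using pal_pow y hy (rfl : c + c = c + c)

lemma Tsum_pal (m c n : ℕ) : PalF (n - m + 2 * c) (Tsum m c n) := by
  apply PalF.sum
  intro r hr
  rw [Finset.Nat.mem_antidiagonalTuple, Fin.sum_univ_succ] at hr
  have h := (((PalF.natCast (Nat.multinomial Finset.univ r)).mul (PalF.X_pow c)).mul (dA_pal (r 0))).mul
    (PalF.prod (fun i : Fin m => ((r i.succ : ℤ) - 1)) univ (fun i => Apoly (r i.succ)) fun i _ => Apoly_pal _)
  convert h using 1
  rw [← hr, Finset.sum_sub_distrib]
  simp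
  ring

lemma pal_of_coeff (m : ℕ) (p : ℝ[X]) (hd : p.degree ≤ (m : WithBot ℕ))
    (hs : ∀ k ≤ m, p.coeff k = p.coeff (m - k)) : PalF m p := by
  intro y hy
  have hd' : p.natDegree < m + 1 := Nat.lt_succ_of_le (Polynomial.natDegree_le_iff_degree_le.2 hd)
  rw [Polynomial.eval_eq_sum_range' hd', Polynomial.eval_eq_sum_range' hd', Finset.mul_sum,
    ← Finset.sum_range_reflect]
  refine Finset.sum_congr rfl fun k hk => ?_
  have hk' : k ≤ m := by simpa [Nat.lt_succ_iff] using hk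
  rw [show m + 1 - 1 - k = m - k by omega, ← hs k hk', zpow_natCast,
    pal_pow y hy (show (m - k) + k = m by omega)]
  ring

lemma pal_zero (n : ℕ) (q : ℝ[X]) (h1 : PalF n q) (h2 : PalF (n + 1 : ℕ) q) : q = 0 := by
  apply Polynomial.eq_zero_of_infinite_isRoot
  refine Set.Infinite.mono ?_ (Set.Ioi_infinite (1 : ℝ))
  intro y hy
  have hy1 : (1 : ℝ) < y := hy
  have hy0 : y ≠ 0 := by positivity
  have e1 := h1 y hy0
  have e2 := h2 y hy0
  rw [zpow_natCast] at e1 e2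
  have e3 : (y - 1) * q.eval y = 0 := by
    rw [pow_succ] at e2
    linear_combination y * e1 - e2
  rcases mul_eq_zero.1 e3 with h | h
  · linarith
  · exact h

/-- `f_n^-`, the symmetric part of `d_n^B` with center of symmetry `(n+1)/2`
(characterized by: `d_n^B = f_n^+ + f_n^-`, `deg f_n^+ ≤ n`, `f_n^+(x) = x^n f_n^+(1/x)`,
`deg f_n^- ≤ n+1`, `f_n^-(x) = x^{n+1} f_n^-(1/x)`), equals
`Σ (n choose r_0,…,r_{2k+1}) x^{k+1} d_{r_0}(x) A_{r_1}(x) ⋯ A_{r_{2k+1}}(x)`,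
summed over all `k ∈ ℕ` and sequences of nonnegative integers summing to `n`
(convention `A_0 = 0`; all terms with `k > n` vanish). -/
theorem fminus_eq_multinomial_sum (n : ℕ)
    (fp fm : Polynomial ℝ)
    (hsum : dB n = fp + fm)
    (hpdeg : fp.degree ≤ (n : WithBot ℕ))
    (hpsymm : ∀ k ≤ n, fp.coeff k = fp.coeff (n - k))
    (hmdeg : fm.degree ≤ ((n + 1 : ℕ) : WithBot ℕ))
    (hmsymm : ∀ k ≤ n + 1, fm.coeff k = fm.coeff (n + 1 - k))
    :
    fm = ∑ k ∈ Finset.range (n + 1),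
      ∑ r ∈ Finset.Nat.antidiagonalTuple (2 * k + 2) n,
        (Nat.multinomial Finset.univ r : Polynomial ℝ) * X ^ (k + 1) *
          dA (r 0) * ∏ i : Fin (2 * k + 1), Apoly (r i.succ) := by

  have hsplit := dB_split n
  have hq : fp - (∑ k ∈ Finset.range (n+1), Tsum (2*k) k n) = 0 := by
    apply pal_zero n
    · refine (pal_of_coeff n fp hpdeg hpsymm).sub (PalF.sum _ _ fun k _ => ?_)
      have := Tsum_pal (2*k) k n
      convert this using 1
      push_cast; ring
    · have h : fp - (∑ k ∈ Finset.range (n+1), Tsum (2*k) k n)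
        = (∑ k ∈ Finset.range (n+1), Tsum (2*k+1) (k+1) n) - fm := by
        linear_combination hsplit - hsum
      rw [h]
      refine (PalF.sum _ _ fun k _ => ?_).sub (pal_of_coeff (n+1) fm hmdeg hmsymm)
      have := Tsum_pal (2*k+1) (k+1) n
      convert this using 1
      push_cast; ring
  have : fm = ∑ k ∈ Finset.range (n+1), Tsum (2*k+1) (k+1) n := by
    linear_combination hsplit - hsum - hq
  rw [this]
  rfl
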